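/- Let q be an odd prime power, δ a multiplicative generator of F_{q^m}^×, and let g(x) be the minimal polynomial of δ over F_q (of degree m). Then g(x²) is irreducible of degree 2m over F_q; equivalently, any square root of δ in an algebraic closure generates the field F_{q^{2m}} over F_q. -/

import Mathlib

open Polynomial

theorem stmt7_aux (F K L : Type*) [Field F] [Field K] [Field L] [Fintype F] [Fintype K]
    [Algebra F K] [Algebra K L] [Algebra F L] [IsScalarTower F K L]
    (q m : ℕ) (hq : Odd q) (hm : 0 < m)
    (hF : Fintype.card F = q) (hK : Fintype.card K = q ^ m)
    (δ : Kˣ) (hδ : ∀ x : Kˣ, x ∈ Subgroup.zpowers δ) :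
    (minpoly F (δ : K)).natDegree = m ∧
    ∀ s : L, s ^ 2 = algebraMap K L (δ : K) →
      IsIntegral F s ∧ Module.finrank F (IntermediateField.adjoin F {s}) = 2 * m := by
  have hq1 : 1 < q := hF ▸ Fintype.one_lt_card
  have hfin : Module.finrank F K = m := by
    have h := Module.card_eq_pow_finrank (K := F) (V := K)
    rw [hF, hK] at h
    exact (Nat.pow_right_injective hq1 h).symm
  have htop : IntermediateField.adjoin F {(δ : K)} = ⊤ := by
    rw [eq_top_iff]
    intro x _
    by_cases hx : x = 0
    · rw [hx]; exact zero_mem _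
    · obtain ⟨k, hk⟩ := Subgroup.mem_zpowers_iff.1 (hδ (Units.mk0 x hx))
      have : x = (δ : K) ^ k := by
        rw [← Units.val_zpow_eq_zpow_val, hk]; rfl
      rw [this]
      exact zpow_mem (IntermediateField.mem_adjoin_simple_self F _) k
  refine ⟨?_, ?_⟩
  · rw [← IntermediateField.adjoin.finrank (IsIntegral.of_finite F (δ : K)), htop,
      IntermediateField.finrank_top', hfin]
  intro s hs
  have hord : orderOf δ = q ^ m - 1 := by
    rw [orderOf_eq_card_of_forall_mem_zpowers hδ, Nat.card_units, Nat.card_eq_fintype_card, hK]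
  have hev : Even (q ^ m - 1) := (hq.pow).tsub_odd odd_one
  have hns : ∀ b : K, b ^ 2 ≠ (δ : K) := by
    intro b hb
    have hb0 : b ≠ 0 := by
      rintro rfl
      exact δ.ne_zero (by rw [← hb]; simp)
    obtain ⟨k, hk⟩ := Subgroup.mem_zpowers_iff.1 (hδ (Units.mk0 b hb0))
    have h1 : (δ ^ k) ^ 2 = δ := by
      rw [hk]; ext; simpa using hb
    have h2 : δ ^ (2 * k - 1) = 1 := by
      rw [zpow_sub, mul_comm 2 k, zpow_mul, zpow_one]
      rw [show (δ ^ k) ^ (2 : ℤ) = δ by exact_mod_cast h1]; simp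
    have h3 := orderOf_dvd_iff_zpow_eq_one.2 h2
    rw [hord] at h3
    have h4 : (2 : ℤ) ∣ ((q ^ m - 1 : ℕ) : ℤ) := by exact_mod_cast hev.two_dvd
    have := h4.trans h3
    omega
  have hirr : Irreducible (X ^ 2 - C (δ : K)) := X_pow_sub_C_irreducible_of_prime Nat.prime_two hns
  have hmin : X ^ 2 - C (δ : K) = minpoly K s :=
    minpoly.eq_of_irreducible_of_monic hirr (by simp [hs]) (monic_X_pow_sub_C _ two_ne_zero)
  have hsK : IsIntegral K s := ⟨_, monic_X_pow_sub_C (δ : K) two_ne_zero, by simp [hs]⟩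
  have h2 : Module.finrank K (IntermediateField.adjoin K {s}) = 2 := by
    rw [IntermediateField.adjoin.finrank hsK, ← hmin, natDegree_X_pow_sub_C]
  have hsF : IsIntegral F s := isIntegral_trans s hsK
  refine ⟨hsF, ?_⟩
  have hKs : ∀ x : K, algebraMap K L x ∈ IntermediateField.adjoin F {s} := by
    intro x
    by_cases hx : x = 0
    · rw [hx, map_zero]; exact zero_mem _
    · obtain ⟨k, hk⟩ := Subgroup.mem_zpowers_iff.1 (hδ (Units.mk0 x hx))
      have : x = (δ : K) ^ k := by
        rw [← Units.val_zpow_eq_zpow_val, hk]; rfl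
      rw [this, map_zpow₀, ← hs]
      exact zpow_mem (pow_mem (IntermediateField.mem_adjoin_simple_self F _) 2) k
  have heq : IntermediateField.adjoin F {s} =
      (IntermediateField.adjoin K {s}).restrictScalars F := by
    apply le_antisymm
    · rw [IntermediateField.adjoin_simple_le_iff]
      exact IntermediateField.mem_adjoin_simple_self K s
    · intro x hx
      have hx' : x ∈ IntermediateField.adjoin K {s} := hx
      induction hx' using IntermediateField.adjoin_induction with
      | mem y hy => exact IntermediateField.subset_adjoin F _ hy
      | algebraMap y => exact hKs y
      | add y z hy hz h1 h2 => exact add_mem (h1 hy) (h2 hz)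
      | inv y hy h1 => exact inv_mem (h1 hy)
      | mul y z hy hz h1 h2 => exact mul_mem (h1 hy) (h2 hz)
  rw [heq]
  have h3 : Module.finrank F (IntermediateField.adjoin K {s}) = 2 * m := by
    rw [← Module.finrank_mul_finrank F K, hfin, h2, mul_comm]
  exact h3

/-- Any `F`-algebra structure on an extension of `K` factors through `K`. -/
theorem stmt7_lift (F K L : Type*) [Field F] [Field K] [Field L] [Fintype F] [Fintype K]
    [Algebra K L] [Algebra F L] (q m : ℕ)
    (hF : Fintype.card F = q) (hK : Fintype.card K = q ^ m) :
    ∃ f : F →+* K, (algebraMap K L).comp f = algebraMap F L := by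
  have hr : ∀ x : F, algebraMap F L x ∈ (algebraMap K L).range := by
    intro x
    have hx : x ^ (q ^ m) = x := by rw [← hF]; exact FiniteField.pow_card_pow m x
    have hsp : (X ^ Fintype.card K - X : K[X]).Splits := by
      rw [splits_iff_card_roots, FiniteField.roots_X_pow_card_sub_X,
        FiniteField.X_pow_card_sub_X_natDegree_eq K Fintype.one_lt_card]
      rfl
    refine Splits.mem_range_of_isRoot hsp
      (FiniteField.X_pow_card_sub_X_ne_zero K Fintype.one_lt_card) ?_
    simp [hK, ← map_pow, hx]
  let e := RingEquiv.ofBijective (algebraMap K L).rangeRestrict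
    ⟨(algebraMap K L).rangeRestrict.injective,
      (algebraMap K L).rangeRestrict_surjective⟩
  refine ⟨(e.symm : (algebraMap K L).range →+* K).comp ((algebraMap F L).codRestrict _ hr), ?_⟩
  ext x
  exact congrArg Subtype.val (e.apply_symm_apply ⟨algebraMap F L x, hr x⟩)

/-- The degree statement for an arbitrary `F`-algebra structure on `L`. -/
theorem stmt7_aux2 (F K L : Type*) [Field F] [Field K] [Field L] [Fintype F] [Fintype K]
    [Algebra K L] [Algebra F L]
    (q m : ℕ) (hq : Odd q) (hm : 0 < m)
    (hF : Fintype.card F = q) (hK : Fintype.card K = q ^ m)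
    (δ : Kˣ) (hδ : ∀ x : Kˣ, x ∈ Subgroup.zpowers δ) (s : L)
    (hs : s ^ 2 = algebraMap K L (δ : K)) :
    Module.finrank F (IntermediateField.adjoin F {s}) = 2 * m := by
  obtain ⟨f, hf⟩ := stmt7_lift F K L q m hF hK
  letI : Algebra F K := f.toAlgebra
  haveI : IsScalarTower F K L := IsScalarTower.of_algebraMap_eq' hf.symm
  exact ((stmt7_aux F K L q m hq hm hF hK δ hδ).2 s hs).2

/-- The irreducibility statement. -/
theorem stmt7_irr (F K L : Type*) [Field F] [Field K] [Field L] [Fintype F] [Fintype K]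
    [Algebra F K] [Algebra K L] [Algebra F L] [IsScalarTower F K L] [IsAlgClosed L]
    (q m : ℕ) (hq : Odd q) (hm : 0 < m)
    (hF : Fintype.card F = q) (hK : Fintype.card K = q ^ m)
    (δ : Kˣ) (hδ : ∀ x : Kˣ, x ∈ Subgroup.zpowers δ) :
    Irreducible ((minpoly F (δ : K)).comp (X ^ 2)) ∧
    ((minpoly F (δ : K)).comp (X ^ 2)).natDegree = 2 * m := by
  obtain ⟨hdeg, H⟩ := stmt7_aux F K L q m hq hm hF hK δ hδ
  have hd : ((minpoly F (δ : K)).comp (X ^ 2)).natDegree = 2 * m := by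
    rw [natDegree_comp, hdeg, natDegree_X_pow, mul_comm]
  refine ⟨?_, hd⟩
  obtain ⟨s, hs⟩ := IsAlgClosed.exists_pow_nat_eq
    (algebraMap K L (δ : K)) two_pos
  obtain ⟨hi, hr⟩ := H s hs
  have hmon : ((minpoly F (δ : K)).comp (X ^ 2)).Monic :=
    (minpoly.monic (IsIntegral.of_finite F (δ : K))).comp (monic_X_pow 2) (by simp)
  have hdvd : minpoly F s ∣ (minpoly F (δ : K)).comp (X ^ 2) := by
    apply minpoly.dvd
    rw [aeval_comp, map_pow, aeval_X, hs, aeval_algebraMap_apply, minpoly.aeval, map_zero]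
  rw [IntermediateField.adjoin.finrank hi] at hr
  have := eq_of_monic_of_dvd_of_natDegree_le (minpoly.monic hi) hmon hdvd (by rw [hd, hr])
  rw [this]
  exact minpoly.irreducible hi

/-- Let `q` be an odd prime power, `F = 𝔽_q ⊆ K = 𝔽_{q^m}`, `δ` a generator of
`Kˣ`, and `g` the minimal polynomial of `δ` over `F` (of degree `m`). Then
`g(x²)` is irreducible of degree `2m` over `F`; equivalently any square root of
`δ` in an algebraic closure generates an extension of degree `2m` of `F`. -/
theorem stmt7 (F K : Type*) [Field F] [Field K] [Fintype F] [Fintype K]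
    [Algebra F K] (q m : ℕ) (hq : Odd q) (hm : 0 < m)
    (hF : Fintype.card F = q) (hK : Fintype.card K = q ^ m)
    (δ : Kˣ) (hδ : ∀ x : Kˣ, x ∈ Subgroup.zpowers δ)
    [Algebra F (AlgebraicClosure K)] [IsScalarTower F K (AlgebraicClosure K)] :
    Irreducible ((minpoly F (δ : K)).comp (X ^ 2)) ∧
    ((minpoly F (δ : K)).comp (X ^ 2)).natDegree = 2 * m ∧
    ∀ s : AlgebraicClosure K, s ^ 2 = algebraMap K (AlgebraicClosure K) (δ : K) →
      Module.finrank F (IntermediateField.adjoin F {s}) = 2 * m := by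
  have h := @stmt7_irr F K (AlgebraicClosure K) _ _ _ _ _ _ _
    (AlgebraicClosure.instAlgebra K) (inferInstance) _ q m hq hm hF hK δ hδ
  exact ⟨h.1, h.2, fun s hs => stmt7_aux2 F K (AlgebraicClosure K) q m hq hm hF hK δ hδ s hs⟩
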